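/- If u is a ground state, or a solution of the IVP that changes sign on (0,∞), then its initial value satisfies u(0) > α^*, where α^* = (2(p+1)/((n+2) − p(n−2)))^{1/(p−1)}. -/

import Mathlib

open Real Filter Set

/-- The nonlinearity `f(s) = -s + |s|^(p-1) s`. -/
noncomputable def f (p s : ℝ) : ℝ := -s + |s| ^ (p - 1) * s

/-- The derivative of the nonlinearity, `f'(s) = -1 + p |s|^(p-1)`. -/
noncomputable def fder (p s : ℝ) : ℝ := -1 + p * |s| ^ (p - 1)

/-- The primitive `F(s) = -s^2/2 + |s|^(p+1)/(p+1)`. -/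
noncomputable def F (p s : ℝ) : ℝ := -s ^ 2 / 2 + |s| ^ (p + 1) / (p + 1)

/-- `u : [0,∞) → ℝ` (modeled on `Set.Ici 0`) is a C² solution of the IVP
`u'' + ((n-1)/r) u' + f(u) = 0`, `u(0) = α`, `u'(0) = 0`; the data `u'`, `u''`
are its first and second derivatives on `[0,∞)`. -/
structure IsSolution (n : ℕ) (p α : ℝ) (u u' u'' : ℝ → ℝ) : Prop where
  init : u 0 = α
  initDeriv : u' 0 = 0
  hasDeriv1 : ∀ r ∈ Set.Ici (0:ℝ), HasDerivWithinAt u (u' r) (Set.Ici 0) r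
  hasDeriv2 : ∀ r ∈ Set.Ici (0:ℝ), HasDerivWithinAt u' (u'' r) (Set.Ici 0) r
  cont2 : ContinuousOn u'' (Set.Ici 0)
  ode : ∀ r : ℝ, 0 < r → u'' r + ((n : ℝ) - 1) / r * u' r + f p (u r) = 0

/-- The variation `v` associated with a solution `u`: the C² solution of the linearized
equation `v'' + ((n-1)/r) v' + f'(u) v = 0`, `v(0) = 1`, `v'(0) = 0`. -/
structure IsVariation (n : ℕ) (p : ℝ) (u v v' v'' : ℝ → ℝ) : Prop where
  init : v 0 = 1
  initDeriv : v' 0 = 0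
  hasDeriv1 : ∀ r ∈ Set.Ici (0:ℝ), HasDerivWithinAt v (v' r) (Set.Ici 0) r
  hasDeriv2 : ∀ r ∈ Set.Ici (0:ℝ), HasDerivWithinAt v' (v'' r) (Set.Ici 0) r
  cont2 : ContinuousOn v'' (Set.Ici 0)
  ode : ∀ r : ℝ, 0 < r → v'' r + ((n : ℝ) - 1) / r * v' r + fder p (u r) * v r = 0

/-- `u` is decaying: `u(r) → 0` and `u'(r) → 0` as `r → ∞`. -/
def Decaying (u u' : ℝ → ℝ) : Prop :=
  Filter.Tendsto u Filter.atTop (nhds 0) ∧ Filter.Tendsto u' Filter.atTop (nhds 0)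

/-- `u` changes sign on `(0,∞)`. -/
def ChangesSign (u : ℝ → ℝ) : Prop :=
  (∃ r : ℝ, 0 < r ∧ u r < 0) ∧ (∃ r : ℝ, 0 < r ∧ 0 < u r)

/-- `z 0 < z 1 < ⋯ < z (k-1)` are exactly the zeros of `u` in `(0,∞)`. -/
def ExactZeros (u : ℝ → ℝ) (k : ℕ) (z : Fin k → ℝ) : Prop :=
  StrictMono z ∧ (∀ i, 0 < z i ∧ u (z i) = 0) ∧
    ∀ r : ℝ, 0 < r → u r = 0 → ∃ i, r = z i

lemma abs_rpow_add_one {p : ℝ} (hp : 1 < p) (s : ℝ) :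
    |s| ^ (p + 1) = |s| ^ (p - 1) * s ^ 2 := by
  have h : p + 1 = (p - 1) + (2 : ℕ) := by push_cast; ring
  rw [h, rpow_add_of_nonneg (abs_nonneg s) (by linarith) (by positivity), rpow_natCast, sq_abs]

lemma F_eq {p : ℝ} (hp : 1 < p) (s : ℝ) :
    F p s = s ^ 2 * (-1 / 2 + |s| ^ (p - 1) / (p + 1)) := by
  rw [F, abs_rpow_add_one hp]; ring

lemma hasDerivAt_F {p : ℝ} (hp : 1 < p) (s : ℝ) : HasDerivAt (F p) (f p s) s := by
  have h1 : HasDerivAt (fun x : ℝ => |x| ^ (p + 1)) ((p + 1) * |s| ^ (p + 1 - 2) * s) s :=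
    hasDerivAt_abs_rpow s (by linarith)
  have h2 : HasDerivAt (fun x : ℝ => -x ^ 2 / 2) (-s) s := by
    refine ((hasDerivAt_pow 2 s).neg.div_const 2).congr_deriv ?_
    push_cast; ring
  refine HasDerivAt.congr_deriv (f := F p) (h2.add (h1.div_const (p + 1))) ?_
  have h3 : p + 1 - 2 = p - 1 := by ring
  have h4 : p + 1 ≠ 0 := by linarith
  rw [f, h3]; field_simp

/-- `F(s) ≤ F(t)` as soon as `|s| ≤ |t|` and `|t|` is at least the positive zero of `F`. -/
lemma F_le_F {p : ℝ} (hp : 1 < p) {s t : ℝ} (hst : |s| ≤ |t|)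
    (ht : 0 ≤ -1 / 2 + |t| ^ (p - 1) / (p + 1)) : F p s ≤ F p t := by
  rw [F_eq hp, F_eq hp]
  have h1 : |s| ^ (p - 1) / (p + 1) ≤ |t| ^ (p - 1) / (p + 1) := by
    gcongr
  calc s ^ 2 * (-1 / 2 + |s| ^ (p - 1) / (p + 1))
      ≤ s ^ 2 * (-1 / 2 + |t| ^ (p - 1) / (p + 1)) := by gcongr
    _ ≤ t ^ 2 * (-1 / 2 + |t| ^ (p - 1) / (p + 1)) :=
        mul_le_mul_of_nonneg_right (sq_le_sq.mpr hst) ht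

lemma F_nonpos_of_f_eq_zero {p : ℝ} (hp : 1 < p) {s : ℝ} (hs : f p s = 0) : F p s ≤ 0 := by
  have h : |s| ^ (p - 1) * s ^ 2 = s ^ 2 := by rw [f] at hs; linear_combination s * hs
  have h' : F p s = -(s ^ 2 * (p - 1) / (2 * (p + 1))) := by
    have h4 : p + 1 ≠ 0 := by linarith
    rw [F, abs_rpow_add_one hp, h]
    field_simp
    ring
  rw [h', neg_nonpos]
  exact div_nonneg (mul_nonneg (sq_nonneg s) (by linarith)) (by linarith)

/-- The energy `E(r) = u'(r)² / 2 + F(u(r))`. -/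
noncomputable def energy (p : ℝ) (u u' : ℝ → ℝ) (r : ℝ) : ℝ := u' r ^ 2 / 2 + F p (u r)

/-- The Pohozaev function `r^n E(r) + ((n-2)/2) r^(n-1) u(r) u'(r)`. -/
noncomputable def pohozaev (n : ℕ) (p : ℝ) (u u' : ℝ → ℝ) (r : ℝ) : ℝ :=
  r ^ n * energy p u u' r + ((n : ℝ) - 2) / 2 * (r ^ (n - 1) * (u r * u' r))

namespace IsSolution

variable {n : ℕ} {p α : ℝ} {u u' u'' : ℝ → ℝ}

lemma hasDerivAt_fst (hu : IsSolution n p α u u' u'') {r : ℝ} (hr : 0 < r) :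
    HasDerivAt u (u' r) r :=
  (hu.hasDeriv1 r hr.le).hasDerivAt (Ici_mem_nhds hr)

lemma hasDerivAt_snd (hu : IsSolution n p α u u' u'') {r : ℝ} (hr : 0 < r) :
    HasDerivAt u' (u'' r) r :=
  (hu.hasDeriv2 r hr.le).hasDerivAt (Ici_mem_nhds hr)

lemma continuousOn_fst (hu : IsSolution n p α u u' u'') : ContinuousOn u (Ici 0) :=
  fun r hr => (hu.hasDeriv1 r hr).continuousWithinAt

lemma continuousOn_snd (hu : IsSolution n p α u u' u'') : ContinuousOn u' (Ici 0) :=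
  fun r hr => (hu.hasDeriv2 r hr).continuousWithinAt

lemma continuousOn_energy (hu : IsSolution n p α u u' u'') (hp : 1 < p) :
    ContinuousOn (energy p u u') (Ici 0) := by
  have hF : Continuous (F p) :=
    continuous_iff_continuousAt.mpr fun s => (hasDerivAt_F hp s).continuousAt
  exact ((hu.continuousOn_snd.pow 2).div_const 2).add (hF.comp_continuousOn hu.continuousOn_fst)

lemma continuousOn_pohozaev (hu : IsSolution n p α u u' u'') (hp : 1 < p) :
    ContinuousOn (pohozaev n p u u') (Ici 0) :=
  ((continuous_pow n).continuousOn.mul (hu.continuousOn_energy hp)).add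
    (continuousOn_const.mul ((continuous_pow (n - 1)).continuousOn.mul
      (hu.continuousOn_fst.mul hu.continuousOn_snd)))

lemma hasDerivAt_energy (hu : IsSolution n p α u u' u'') (hp : 1 < p) {r : ℝ} (hr : 0 < r) :
    HasDerivAt (energy p u u') (-(((n : ℝ) - 1) / r * u' r ^ 2)) r := by
  have h := (((hu.hasDerivAt_snd hr).pow 2).div_const 2).add
    ((hasDerivAt_F hp (u r)).comp r (hu.hasDerivAt_fst hr))
  refine HasDerivAt.congr_deriv (f := energy p u u') h ?_
  push_cast
  linear_combination u' r * hu.ode r hr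

lemma hasDerivAt_pohozaev (hu : IsSolution n p α u u' u'') (hn : 3 ≤ n) (hp : 1 < p)
    {r : ℝ} (hr : 0 < r) :
    HasDerivAt (pohozaev n p u u') (r ^ (n - 1) * u r ^ 2 *
      (-1 + |u r| ^ (p - 1) * (((n : ℝ) + 2 - p * (n - 2)) / (2 * (p + 1))))) r := by
  have h := ((hasDerivAt_pow n r).mul (hu.hasDerivAt_energy hp hr)).add
    (((hasDerivAt_pow (n - 1) r).mul
      ((hu.hasDerivAt_fst hr).mul (hu.hasDerivAt_snd hr))).const_mul (((n : ℝ) - 2) / 2))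
  refine HasDerivAt.congr_deriv (f := pohozaev n p u u') h ?_
  have hode := hu.ode r hr
  have hu2 : u'' r = -(((n : ℝ) - 1) / r * u' r) - f p (u r) := by linarith
  obtain ⟨m, rfl⟩ : ∃ m, n = m + 3 := ⟨n - 3, by omega⟩
  have h4 : p + 1 ≠ 0 := by linarith
  simp only [Pi.mul_apply, energy, hu2, F, f, abs_rpow_add_one hp]
  simp only [show m + 3 - 1 = m + 2 from rfl, show m + 2 - 1 = m + 1 from rfl]
  push_cast
  field_simp
  ring

lemma antitoneOn_energy (hu : IsSolution n p α u u' u'') (hn : 3 ≤ n) (hp : 1 < p) :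
    AntitoneOn (energy p u u') (Ici 0) := by
  refine antitoneOn_of_hasDerivWithinAt_nonpos (convex_Ici 0) (hu.continuousOn_energy hp)
    (f' := fun r => -(((n : ℝ) - 1) / r * u' r ^ 2)) ?_ ?_
  · intro r hr
    rw [interior_Ici] at hr
    exact (hu.hasDerivAt_energy hp hr).hasDerivWithinAt
  · intro r hr
    rw [interior_Ici] at hr
    have h1 : (3 : ℝ) ≤ n := by exact_mod_cast hn
    have h2 : 0 < r := hr
    have h3 : 0 ≤ ((n : ℝ) - 1) / r := div_nonneg (by linarith) h2.le
    exact neg_nonpos.mpr (mul_nonneg h3 (sq_nonneg _))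

lemma energy_zero (hu : IsSolution n p α u u' u'') : energy p u u' 0 = F p α := by
  simp [energy, hu.init, hu.initDeriv]

lemma pohozaev_zero (hn : 3 ≤ n) : pohozaev n p u u' 0 = 0 := by
  simp [pohozaev, show n ≠ 0 by omega, show n - 1 ≠ 0 by omega]

/-- A solution starting at height at most `A`, with `F(A) > 0`, stays strictly below `A`. -/
lemma abs_lt (hu : IsSolution n p α u u' u'') (hn : 3 ≤ n) (hp : 1 < p) {A : ℝ} (hA : 0 < A)
    (hFA : 0 < -1 / 2 + A ^ (p - 1) / (p + 1)) (hα : 0 < α) (hαA : α ≤ A) {r : ℝ} (hr : 0 < r) :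
    |u r| < A := by
  by_contra! hcon
  have hposA : 0 < F p A := by
    rw [F_eq hp, abs_of_pos hA]; positivity
  have hle : F p α ≤ F p A :=
    F_le_F hp (by rwa [abs_of_pos hα, abs_of_pos hA]) (by rw [abs_of_pos hA]; exact hFA.le)
  have hge : F p A ≤ F p (u r) := by
    refine F_le_F hp (by rwa [abs_of_pos hA]) (hFA.le.trans ?_)
    gcongr
  have hanti := hu.antitoneOn_energy hn hp
  have hEr : F p A ≤ energy p u u' r := by
    have : 0 ≤ u' r ^ 2 / 2 := by positivity
    rw [energy]; linarith
  have hconst : ∀ s ∈ Ioo 0 r, energy p u u' s = F p A := by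
    intro s hs
    have h1 := hanti (mem_Ici.mpr le_rfl) (mem_Ici.mpr hs.1.le) hs.1.le
    have h2 := hanti (mem_Ici.mpr hs.1.le) (mem_Ici.mpr hr.le) hs.2.le
    rw [hu.energy_zero] at h1
    linarith
  have hd : ∀ s ∈ Ioo 0 r, u' s = 0 := by
    intro s hs
    have h1 : HasDerivAt (energy p u u') 0 s :=
      (hasDerivAt_const s (F p A)).congr_of_eventuallyEq
        (Filter.eventuallyEq_of_mem (Ioo_mem_nhds hs.1 hs.2) hconst)
    have h2 := (hu.hasDerivAt_energy hp hs.1).unique h1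
    have h3 : (3 : ℝ) ≤ n := by exact_mod_cast hn
    have h4 : ((n : ℝ) - 1) / s ≠ 0 := (div_pos (by linarith) hs.1).ne'
    simpa [h4] using h2
  have hmid : r / 2 ∈ Ioo 0 r := ⟨by linarith, by linarith⟩
  have hdd : u'' (r / 2) = 0 :=
    (hu.hasDerivAt_snd hmid.1).unique ((hasDerivAt_const _ 0).congr_of_eventuallyEq
      (Filter.eventuallyEq_of_mem (Ioo_mem_nhds hmid.1 hmid.2) hd))
  have hode := hu.ode _ hmid.1
  rw [hdd, hd _ hmid] at hode
  have hF := F_nonpos_of_f_eq_zero hp (s := u (r / 2)) (by linarith)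
  have hE := hconst _ hmid
  rw [energy, hd _ hmid] at hE
  linarith

/-- The Pohozaev function is strictly decreasing where `0 < u` and `|u|` is below the threshold. -/
lemma strictAntiOn_pohozaev (hu : IsSolution n p α u u' u'') (hn : 3 ≤ n) (hp : 1 < p)
    {S : Set ℝ} (hS : Convex ℝ S) (hS0 : S ⊆ Ici 0)
    (hpos : ∀ r ∈ interior S, 0 < u r)
    (hlt : ∀ r ∈ interior S,
      |u r| ^ (p - 1) * (((n : ℝ) + 2 - p * (n - 2)) / (2 * (p + 1))) < 1) :
    StrictAntiOn (pohozaev n p u u') S := by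
  have hint : ∀ r ∈ interior S, 0 < r := fun r hr => by
    have := interior_mono hS0 hr
    rwa [interior_Ici] at this
  refine strictAntiOn_of_hasDerivWithinAt_neg hS ((hu.continuousOn_pohozaev hp).mono hS0)
    (fun r hr => (hu.hasDerivAt_pohozaev hn hp (hint r hr)).hasDerivWithinAt) ?_
  intro r hr
  have h0 := hint r hr
  have h1 := hpos r hr
  exact mul_neg_of_pos_of_neg (by positivity) (by linarith [hlt r hr])

/-- A solution with nonpositive value somewhere has a first zero. -/
lemma exists_first_zero (hu : IsSolution n p α u u' u'') (hα : 0 < α) {r : ℝ} (hr : 0 < r)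
    (hur : u r ≤ 0) : ∃ z, 0 < z ∧ u z = 0 ∧ ∀ s ∈ Ico 0 z, 0 < u s := by
  have hc : ∀ b, ContinuousOn u (Icc 0 b) := fun b => hu.continuousOn_fst.mono Icc_subset_Ici_self
  have h0 : 0 < u 0 := by rw [hu.init]; exact hα
  have hK : IsCompact (Icc 0 r ∩ u ⁻¹' {0}) :=
    isCompact_Icc.of_isClosed_subset
      ((hc r).preimage_isClosed_of_isClosed isClosed_Icc isClosed_singleton) inter_subset_left
  obtain ⟨c, hc1, hc2⟩ := intermediate_value_Icc' hr.le (hc r) ⟨hur, h0.le⟩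
  obtain ⟨z, ⟨hz1, hz2⟩, hzl⟩ := hK.exists_isLeast ⟨c, hc1, hc2⟩
  have hz2 : u z = 0 := hz2
  have hz0 : 0 < z := lt_of_le_of_ne hz1.1 fun h => by
    rw [← h] at hz2; linarith
  refine ⟨z, hz0, hz2, fun s hs => ?_⟩
  by_contra! hcon
  obtain ⟨d, hd1, hd2⟩ := intermediate_value_Icc' hs.1 (hc s) ⟨hcon, h0.le⟩
  have := hzl ⟨⟨hd1.1, hd1.2.trans (hs.2.le.trans hz1.2)⟩, hd2⟩
  linarith [hd1.2, hs.2]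

lemma energy_nonneg_of_decaying (hu : IsSolution n p α u u' u'') (hn : 3 ≤ n) (hp : 1 < p)
    (hdec : Decaying u u') {r : ℝ} (hr : 0 ≤ r) : 0 ≤ energy p u u' r := by
  have hlim : Tendsto (energy p u u') atTop (nhds 0) := by
    have h1 := (hdec.2.pow 2).div_const 2
    have h2 := ((hasDerivAt_F hp 0).continuousAt.tendsto).comp hdec.1
    have h3 := h1.add h2
    have h4 : (0 : ℝ) ^ 2 / 2 + F p 0 = 0 := by simp [F_eq hp]
    rw [h4] at h3
    exact h3
  refine le_of_tendsto hlim ?_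
  filter_upwards [eventually_ge_atTop r] with s hs
  exact hu.antitoneOn_energy hn hp hr (hr.trans hs) hs

/-- A positive decaying solution cannot have its Pohozaev function bounded above by a negative
constant near infinity. -/
lemma false_of_pohozaev_le (hu : IsSolution n p α u u' u'') (hn : 3 ≤ n) (hp : 1 < p)
    (hdec : Decaying u u') (hpos : ∀ r, 0 ≤ r → 0 < u r) {c : ℝ} (hc : 0 < c)
    (hP : ∀ r, 1 ≤ r → pohozaev n p u u' r ≤ -c) : False := by
  have hn3 : (3 : ℝ) ≤ n := by exact_mod_cast hn
  set k : ℝ := 2 * c / ((n : ℝ) - 2) with hk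
  have hk0 : 0 < k := div_pos (by linarith) (by linarith)
  have huu : ∀ r, 1 ≤ r → r ^ (n - 1) * (u r * u' r) ≤ -k := by
    intro r hr
    have h1 := hP r hr
    have h2 := hu.energy_nonneg_of_decaying hn hp hdec (r := r) (by linarith)
    have h3 : 0 ≤ r ^ n * energy p u u' r := mul_nonneg (by positivity) h2
    rw [pohozaev] at h1
    have h4 : ((n : ℝ) - 2) / 2 * (r ^ (n - 1) * (u r * u' r)) ≤ -c := by linarith
    rw [hk, ← neg_div, le_div_iff₀ (by linarith)]
    linarith
  have hu'neg : ∀ r, 1 ≤ r → u' r < 0 := by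
    intro r hr
    by_contra! h
    have h1 := hpos r (by linarith)
    have h2 : 0 ≤ r ^ (n - 1) * (u r * u' r) :=
      mul_nonneg (by positivity) (mul_nonneg h1.le h)
    linarith [huu r hr]
  have hsmall : ∀ᶠ r in atTop, |u r| ^ (p - 1) < 1 / 2 := by
    have h1 : Tendsto (fun r => |u r| ^ (p - 1)) atTop (nhds (|0| ^ (p - 1))) :=
      hdec.1.abs.rpow_const (Or.inr (by linarith))
    rw [abs_zero, zero_rpow (by linarith)] at h1
    exact h1.eventually_lt_const (by norm_num)
  obtain ⟨R₀, hR₀⟩ := eventually_atTop.mp hsmall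
  set R : ℝ := max R₀ (2 * n) with hR
  have hRn : 2 * (n : ℝ) ≤ R := le_max_right _ _
  have hR1 : 1 ≤ R := by linarith
  have hdecay : ∀ r, R ≤ r → u r ≤ -2 * u' r := by
    intro r hr
    have h1 := hu.energy_nonneg_of_decaying hn hp hdec (r := r) (by linarith)
    have h2 := hR₀ r ((le_max_left _ _).trans hr)
    have h3 : |u r| ^ (p - 1) / (p + 1) ≤ 1 / 4 := by
      rw [div_le_iff₀ (by linarith)]; linarith
    have h4 : u r ^ 2 * (-1 / 2 + |u r| ^ (p - 1) / (p + 1)) ≤ u r ^ 2 * (-1 / 4) :=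
      mul_le_mul_of_nonneg_left (by linarith) (sq_nonneg _)
    rw [energy, F_eq hp] at h1
    have h5 := hu'neg r (hR1.trans hr)
    exact abs_le_of_sq_le_sq' (by nlinarith [sq_nonneg (u' r)]) (by linarith) |>.2
  have hanti : AntitoneOn (fun r => r ^ (n - 2) * u r ^ 2 + k * Real.log r) (Ici R) := by
    have hder : ∀ r, R ≤ r → HasDerivAt (fun r => r ^ (n - 2) * u r ^ 2 + k * Real.log r)
        (((n - 2 : ℕ) : ℝ) * r ^ (n - 2 - 1) * u r ^ 2
          + r ^ (n - 2) * (2 * u r * u' r) + k * r⁻¹) r := by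
      intro r hr
      have h0 : 0 < r := by linarith
      refine (((hasDerivAt_pow (n - 2) r).mul ((hu.hasDerivAt_fst h0).pow 2)).add
        ((Real.hasDerivAt_log h0.ne').const_mul k)).congr_deriv ?_
      push_cast; simp
    refine antitoneOn_of_hasDerivWithinAt_nonpos (convex_Ici R)
      (fun r hr => (hder r hr).continuousAt.continuousWithinAt)
      (fun r hr => (hder r (interior_subset hr)).hasDerivWithinAt) ?_
    intro r hr
    have hr : R ≤ r := interior_subset hr
    have h0 : 0 < r := by linarith
    have h1 := huu r (hR1.trans hr)
    have h2 := hdecay r hr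
    have h3 := hpos r h0.le
    obtain ⟨m, rfl⟩ : ∃ m, n = m + 3 := ⟨n - 3, by omega⟩
    simp only [show m + 3 - 2 = m + 1 from rfl, show m + 3 - 1 = m + 2 from rfl,
      show m + 1 - 1 = m from rfl] at h1 ⊢
    push_cast at hRn ⊢
    have h4 : 0 ≤ -(u r * u' r) := by
      nlinarith [hu'neg r (hR1.trans hr)]
    have h5 : u r ^ 2 ≤ -2 * (u r * u' r) := by nlinarith
    have h6 : ((m : ℝ) + 1) * u r ^ 2 ≤ r * -(u r * u' r) := by
      calc ((m : ℝ) + 1) * u r ^ 2 ≤ ((m : ℝ) + 1) * (-2 * (u r * u' r)) := by gcongr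
        _ = (2 * (m + 1)) * -(u r * u' r) := by ring
        _ ≤ r * -(u r * u' r) := mul_le_mul_of_nonneg_right (by linarith) h4
    have h7 := mul_le_mul_of_nonneg_left h6 (by positivity : 0 ≤ r ^ m)
    have h8 : k * r⁻¹ ≤ -(r ^ (m + 1) * (u r * u' r)) := by
      rw [← div_eq_mul_inv, div_le_iff₀ h0]
      calc k ≤ -(r ^ (m + 2) * (u r * u' r)) := by linarith
        _ = _ := by ring
    calc _ ≤ r ^ m * (r * -(u r * u' r)) + r ^ (m + 1) * (2 * u r * u' r)
          + -(r ^ (m + 1) * (u r * u' r)) := by linarith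
      _ = 0 := by ring
  have hlog : Tendsto (fun r => k * Real.log r) atTop atTop :=
    Real.tendsto_log_atTop.const_mul_atTop hk0
  obtain ⟨r, hr1, hr2⟩ := ((hlog.eventually_gt_atTop
    (R ^ (n - 2) * u R ^ 2 + k * Real.log R)).and (eventually_ge_atTop R)).exists
  have h1 := hanti (mem_Ici.mpr le_rfl) (mem_Ici.mpr hr2) hr2
  have h2 : 0 ≤ r ^ (n - 2) * u r ^ 2 :=
    mul_nonneg (pow_nonneg (by linarith) _) (sq_nonneg _)
  simp only at h1
  linarith

end IsSolution

/-- a ground state or a sign-changing solution has initial value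
`u(0) > α^* = (2(p+1)/((n+2) - p(n-2)))^(1/(p-1))`. -/
theorem statement7 (n : ℕ) (hn : 3 ≤ n) (p : ℝ) (hp1 : 1 < p)
    (hp2 : p < ((n : ℝ) + 2) / ((n : ℝ) - 2))
    (α : ℝ) (hα : 0 < α)
    (u u' u'' : ℝ → ℝ) (hu : IsSolution n p α u u' u'')
    (h : (Decaying u u' ∧ ∀ r : ℝ, 0 ≤ r → 0 < u r) ∨ ChangesSign u) :
    (2 * (p + 1) / (((n : ℝ) + 2) - p * ((n : ℝ) - 2))) ^ (1 / (p - 1)) < u 0 := by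
  have hn3 : (3 : ℝ) ≤ n := by exact_mod_cast hn
  set D : ℝ := ((n : ℝ) + 2) - p * ((n : ℝ) - 2) with hD
  have hD0 : 0 < D := by
    have := (lt_div_iff₀ (by linarith)).mp hp2
    linarith
  have hD4 : D < 4 := by nlinarith
  have hB0 : 0 < 2 * (p + 1) / D := div_pos (by linarith) hD0
  set A : ℝ := (2 * (p + 1) / D) ^ (1 / (p - 1)) with hA
  have hA0 : 0 < A := rpow_pos_of_pos hB0 _
  have hAp : A ^ (p - 1) = 2 * (p + 1) / D := by
    rw [hA, ← rpow_mul hB0.le, one_div, inv_mul_cancel₀ (by linarith), rpow_one]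
  have hFA : 0 < -1 / 2 + A ^ (p - 1) / (p + 1) := by
    have h1 : A ^ (p - 1) / (p + 1) = 2 / D := by
      have : p + 1 ≠ 0 := by linarith
      rw [hAp]; field_simp
    have h2 : 1 / 2 < 2 / D := by rw [div_lt_div_iff₀ two_pos hD0]; linarith
    linarith
  rw [hu.init]
  by_contra! hαA
  have hlt : ∀ r, 0 < r → |u r| ^ (p - 1) * (D / (2 * (p + 1))) < 1 := by
    intro r hr
    have h1 := rpow_lt_rpow (abs_nonneg _) (hu.abs_lt hn hp1 hA0 hFA hα hαA hr)
      (sub_pos.mpr hp1)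
    rw [hAp] at h1
    rwa [← lt_div_iff₀ (div_pos hD0 (by linarith)), one_div_div]
  rcases h with ⟨hdec, hpos⟩ | ⟨⟨r, hr, hur⟩, -⟩
  · have hanti : StrictAntiOn (pohozaev n p u u') (Ici 0) := by
      refine hu.strictAntiOn_pohozaev hn hp1 (convex_Ici 0) subset_rfl ?_ ?_
      · exact fun r hr => hpos r (interior_subset hr)
      · intro r hr
        rw [interior_Ici] at hr
        exact hlt r hr
    have h1 : pohozaev n p u u' 1 < 0 := by
      have := hanti (mem_Ici.mpr le_rfl) (mem_Ici.mpr zero_le_one) zero_lt_one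
      rwa [IsSolution.pohozaev_zero hn] at this
    refine hu.false_of_pohozaev_le hn hp1 hdec hpos (neg_pos.mpr h1) fun r hr => ?_
    rw [neg_neg]
    exact hanti.antitoneOn (mem_Ici.mpr zero_le_one) (mem_Ici.mpr (zero_le_one.trans hr)) hr
  · obtain ⟨z, hz0, hz, hzpos⟩ := hu.exists_first_zero hα hr hur.le
    have hanti : StrictAntiOn (pohozaev n p u u') (Icc 0 z) := by
      refine hu.strictAntiOn_pohozaev hn hp1 (convex_Icc 0 z) Icc_subset_Ici_self ?_ ?_
      · intro s hs
        rw [interior_Icc] at hs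
        exact hzpos s ⟨hs.1.le, hs.2⟩
      · intro s hs
        rw [interior_Icc] at hs
        exact hlt s hs.1
    have h1 := hanti (left_mem_Icc.mpr hz0.le) (right_mem_Icc.mpr hz0.le) hz0
    rw [IsSolution.pohozaev_zero hn, pohozaev, energy, hz, F_eq hp1] at h1
    have h2 : 0 ≤ z ^ n * (u' z ^ 2 / 2) := by positivity
    simp only [zero_mul, mul_zero, add_zero, ne_eq, OfNat.ofNat_ne_zero, not_false_eq_true,
      zero_pow] at h1
    linarith
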